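/- arXiv:2005.05211 — 3 statements merged into one kernel-verified Lean document; each statement's English description precedes it below -/
import Mathlib

section
/- Under the discretized model, if F_d (C E_d) = I_{n_d}, then the prediction error satisfies the exact recursion x_k − x̂_{k|k−1} = Ā (x_{k−1} − x̂_{k−1}) + Ḡ w + D̄ v, where Ā = (I − E_d F_d C) A_d, Ḡ = (I − E_d F_d C) G_d, and D̄ = −E_d F_d. -/
open Matrix

/-- If F_d (C E_d) = I, the prediction error satisfies the exact
recursion x_k − x̂_{k|k−1} = Ā (x_{k−1} − x̂_{k−1}) + Ḡ w + D̄ v, where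
Ā = (I − E_d F_d C) A_d, Ḡ = (I − E_d F_d C) G_d, D̄ = −E_d F_d. -/
theorem prediction_error_recursion
    {nx nu nd ny : ℕ}
    (Ad : Matrix (Fin nx) (Fin nx) ℝ) (Bd : Matrix (Fin nx) (Fin nu) ℝ)
    (Ed : Matrix (Fin nx) (Fin nd) ℝ) (Gd : Matrix (Fin nx) (Fin nx) ℝ)
    (C : Matrix (Fin ny) (Fin nx) ℝ) (Fd : Matrix (Fin nd) (Fin ny) ℝ)
    (hFd : Fd * (C * Ed) = 1)
    (xkm1 xhat w : Fin nx → ℝ) (u : Fin nu → ℝ) (d : Fin nd → ℝ) (v : Fin ny → ℝ)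
    (xk : Fin nx → ℝ) (yk : Fin ny → ℝ) (xstar : Fin nx → ℝ) (dhat : Fin nd → ℝ)
    (xpred : Fin nx → ℝ)
    (hxk : xk = Ad *ᵥ xkm1 + Bd *ᵥ u + Ed *ᵥ d + Gd *ᵥ w)
    (hyk : yk = C *ᵥ xk + v)
    (hxstar : xstar = Ad *ᵥ xhat + Bd *ᵥ u)
    (hdhat : dhat = Fd *ᵥ (yk - C *ᵥ xstar))
    (hxpred : xpred = Ad *ᵥ xhat + Bd *ᵥ u + Ed *ᵥ dhat) :
    xk - xpred = ((1 - Ed * Fd * C) * Ad) *ᵥ (xkm1 - xhat)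
      + ((1 - Ed * Fd * C) * Gd) *ᵥ w + (-(Ed * Fd)) *ᵥ v := by
  have hd : Fd *ᵥ (C *ᵥ (Ed *ᵥ d)) = d := by
    rw [mulVec_mulVec, mulVec_mulVec, Matrix.mul_assoc, hFd, one_mulVec]
  subst hxpred hdhat hyk hxstar hxk
  simp only [← mulVec_mulVec, sub_mulVec, one_mulVec, neg_mulVec, mulVec_add, mulVec_sub, hd]
  abel
end

section
/- Under the discretized model, if F_d (C E_d) = I_{n_d}, then the filtered estimation error satisfies the exact recursion x_k − x̂_{k|k} = Ã (x_{k−1} − x̂_{k−1}) + G̃ w + D̃ v, where Ã = (I − K C) Ā, G̃ = (I − K C) Ḡ, D̃ = (I − K C) D̄ − K, with Ā = (I − E_d F_d C) A_d, Ḡ = (I − E_d F_d C) G_d, D̄ = −E_d F_d. -/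
open Matrix

/-- If F_d (C E_d) = I, the filtered estimation error satisfies
x_k − x̂_{k|k} = Ã (x_{k−1} − x̂_{k−1}) + G̃ w + D̃ v, where
Ã = (I − K C) Ā, G̃ = (I − K C) Ḡ, D̃ = (I − K C) D̄ − K, with
Ā = (I − E_d F_d C) A_d, Ḡ = (I − E_d F_d C) G_d, D̄ = −E_d F_d. -/
theorem filtered_error_recursion
    {nx nu nd ny : ℕ}
    (Ad : Matrix (Fin nx) (Fin nx) ℝ) (Bd : Matrix (Fin nx) (Fin nu) ℝ)
    (Ed : Matrix (Fin nx) (Fin nd) ℝ) (Gd : Matrix (Fin nx) (Fin nx) ℝ)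
    (C : Matrix (Fin ny) (Fin nx) ℝ) (Fd : Matrix (Fin nd) (Fin ny) ℝ)
    (K : Matrix (Fin nx) (Fin ny) ℝ)
    (hFd : Fd * (C * Ed) = 1)
    (xkm1 xhat w : Fin nx → ℝ) (u : Fin nu → ℝ) (d : Fin nd → ℝ) (v : Fin ny → ℝ)
    (xk : Fin nx → ℝ) (yk : Fin ny → ℝ) (xstar : Fin nx → ℝ) (dhat : Fin nd → ℝ)
    (xpred xfilt : Fin nx → ℝ)
    (hxk : xk = Ad *ᵥ xkm1 + Bd *ᵥ u + Ed *ᵥ d + Gd *ᵥ w)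
    (hyk : yk = C *ᵥ xk + v)
    (hxstar : xstar = Ad *ᵥ xhat + Bd *ᵥ u)
    (hdhat : dhat = Fd *ᵥ (yk - C *ᵥ xstar))
    (hxpred : xpred = Ad *ᵥ xhat + Bd *ᵥ u + Ed *ᵥ dhat)
    (hxfilt : xfilt = xpred + K *ᵥ (yk - C *ᵥ xpred)) :
    xk - xfilt = ((1 - K * C) * ((1 - Ed * Fd * C) * Ad)) *ᵥ (xkm1 - xhat)
      + ((1 - K * C) * ((1 - Ed * Fd * C) * Gd)) *ᵥ w
      + ((1 - K * C) * (-(Ed * Fd)) - K) *ᵥ v := by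
  have hd : Fd *ᵥ (C *ᵥ (Ed *ᵥ d)) = d := by
    rw [mulVec_mulVec, mulVec_mulVec, Matrix.mul_assoc, hFd, one_mulVec]
  have hdhat_eq : dhat = d + Fd *ᵥ (C *ᵥ (Ad *ᵥ (xkm1 - xhat) + Gd *ᵥ w) + v) := by
    rw [hdhat, hyk, hxk, hxstar]
    simp only [mulVec_add, mulVec_sub, hd]
    abel
  have hpred_err : xk - xpred = Ad *ᵥ (xkm1 - xhat) + Gd *ᵥ w
      - Ed *ᵥ (Fd *ᵥ (C *ᵥ (Ad *ᵥ (xkm1 - xhat) + Gd *ᵥ w) + v)) := by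
    rw [hxk, hxpred, hdhat_eq]
    simp only [mulVec_add, mulVec_sub]
    abel
  have hfilt_err : xk - xfilt = (xk - xpred) - K *ᵥ (C *ᵥ (xk - xpred)) - K *ᵥ v := by
    rw [hxfilt, hyk]
    simp only [mulVec_add, mulVec_sub]
    abel
  rw [hfilt_err, hpred_err]
  simp only [← mulVec_mulVec, sub_mulVec, neg_mulVec, one_mulVec, mulVec_add, mulVec_sub,
    mulVec_neg]
  abel
end

section
/- (Corollary 1.) Let n_x = n_y = n_d = n, let C and E_d be invertible n×n real matrices, and set F_d = E_d⁻¹ C⁻¹. Under the discretized model, for every gain K and every prior estimate x̂_{k−1}, the filtered error satisfies x_k − x̂_{k|k} = −C⁻¹ v; in particular the error is independent of the initial estimation error and of the process noise w, so the estimator is stable and robust to initial condition errors. -/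
open Matrix

/-- Corollary 1: with n_x = n_y = n_d = n, C and E_d invertible and
F_d = E_d⁻¹ C⁻¹, for every gain K and every prior estimate x̂_{k−1}, the filtered
error satisfies x_k − x̂_{k|k} = −C⁻¹ v, independent of the initial estimation
error and of the process noise w. -/
theorem one_step_filter_error
    {n nu : ℕ}
    (Ad Gd C Ed : Matrix (Fin n) (Fin n) ℝ) (Bd : Matrix (Fin n) (Fin nu) ℝ)
    (hC : IsUnit C.det) (hEd : IsUnit Ed.det)
    (Fd : Matrix (Fin n) (Fin n) ℝ) (hFd : Fd = Ed⁻¹ * C⁻¹)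
    (K : Matrix (Fin n) (Fin n) ℝ)
    (xkm1 xhat w : Fin n → ℝ) (u : Fin nu → ℝ) (d : Fin n → ℝ) (v : Fin n → ℝ)
    (xk yk xstar : Fin n → ℝ) (dhat : Fin n → ℝ) (xpred xfilt : Fin n → ℝ)
    (hxk : xk = Ad *ᵥ xkm1 + Bd *ᵥ u + Ed *ᵥ d + Gd *ᵥ w)
    (hyk : yk = C *ᵥ xk + v)
    (hxstar : xstar = Ad *ᵥ xhat + Bd *ᵥ u)
    (hdhat : dhat = Fd *ᵥ (yk - C *ᵥ xstar))
    (hxpred : xpred = xstar + Ed *ᵥ dhat)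
    (hxfilt : xfilt = xpred + K *ᵥ (yk - C *ᵥ xpred)) :
    xk - xfilt = -(C⁻¹ *ᵥ v) := by
  have hpred : xpred = C⁻¹ *ᵥ yk := by
    rw [hxpred, hdhat, hFd, mulVec_mulVec, ← Matrix.mul_assoc, mul_nonsing_inv Ed hEd,
      Matrix.one_mul, mulVec_sub, mulVec_mulVec, nonsing_inv_mul C hC, one_mulVec,
      add_sub_cancel]
  have hinnov : yk - C *ᵥ xpred = 0 := by
    rw [hpred, mulVec_mulVec, mul_nonsing_inv C hC, one_mulVec, sub_self]
  rw [hxfilt, hinnov, mulVec_zero, add_zero, hpred, hyk, mulVec_add, mulVec_mulVec,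
    nonsing_inv_mul C hC, one_mulVec, sub_add_cancel_left]
end
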